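/- Let w be a nonempty finite word with heart v. Then |w| + 2 = R_v + K_v + |Alph(w)| if and only if |w| + 2 = L_v + H_v + |Alph(w)|. -/

import Mathlib

open List

variable {A : Type*} [DecidableEq A]

/-- The alphabet of a word: the finite set of distinct letters occurring in it. -/
def Alph (w : List A) : Finset A := w.toFinset

/-- The finset of all factors (contiguous subwords) of `w`. -/
def factors (w : List A) : Finset (List A) :=
  ((Finset.range (w.length + 1)) ×ˢ (Finset.range (w.length + 1))).image
    (fun p => (w.drop p.1).take p.2)

/-- Factor complexity: the number of distinct factors of `w` of length `n`. -/
def C (w : List A) (n : ℕ) : ℕ := ((factors w).filter (fun u => u.length = n)).card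

/-- Right-valence of `u` in `w`: the number of distinct letters `x` such that `u ++ [x]`
is a factor of `w`. -/
def rightValence (w u : List A) : ℕ := ((Alph w).filter (fun x => u ++ [x] <:+: w)).card

/-- `u` is a right special factor of `w`. -/
def RightSpecial (w u : List A) : Prop := u <:+: w ∧ 2 ≤ rightValence w u

/-- `R w`: the smallest positive integer `r` such that `w` has no right special factor
of length `r`. -/
noncomputable def R (w : List A) : ℕ :=
  sInf {r : ℕ | 0 < r ∧ ∀ u : List A, u.length = r → ¬ RightSpecial w u}

/-- The number of occurrences of `u` as a factor of `w`. -/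
def occCount (w u : List A) : ℕ :=
  ((Finset.range (w.length + 1)).filter
    (fun i => i + u.length ≤ w.length ∧ (w.drop i).take u.length = u)).card

/-- `K w`: the length of the shortest suffix of `w` occurring exactly once in `w`. -/
noncomputable def K (w : List A) : ℕ :=
  sInf {k : ℕ | ∃ u : List A, u <:+ w ∧ u.length = k ∧ occCount w u = 1}

/-- Left-valence of `u` in `w`. -/
def leftValence (w u : List A) : ℕ := ((Alph w).filter (fun x => x :: u <:+: w)).card

/-- `u` is a left special factor of `w`. -/
def LeftSpecial (w u : List A) : Prop := u <:+: w ∧ 2 ≤ leftValence w u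

/-- `L w`: the smallest positive integer `ℓ` such that `w` has no left special factor
of length `ℓ`. -/
noncomputable def L (w : List A) : ℕ :=
  sInf {r : ℕ | 0 < r ∧ ∀ u : List A, u.length = r → ¬ LeftSpecial w u}

/-- `H w`: the length of the shortest prefix of `w` occurring exactly once in `w`. -/
noncomputable def H (w : List A) : ℕ :=
  sInf {k : ℕ | ∃ u : List A, u <+: w ∧ u.length = k ∧ occCount w u = 1}

/-- A generalized trapezoidal word. -/
def IsGT (w : List A) : Prop :=
  w ≠ [] ∧ ((Alph w).card = 1 ∨
    ∃ m M : ℕ, 0 < m ∧ m ≤ M ∧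
      (∀ i, 1 ≤ i → i ≤ m → C w i = (Alph w).card + i - 1) ∧
      (∀ i, m ≤ i → i ≤ M - 1 → C w (i + 1) = C w i) ∧
      (∀ i, M ≤ i → i ≤ w.length → C w (i + 1) = C w i - 1))

/-- The heart of a word: remove the longest prefix and longest suffix consisting of
letters that occur exactly once in the word (if some letter repeats); otherwise the
word itself. -/
def heart (w : List A) : List A :=
  if ∀ x ∈ w, w.count x = 1 then w
  else
    ((w.dropWhile (fun x => w.count x == 1)).reverse.dropWhile
      (fun x => w.count x == 1)).reverse

/-- A word is rich if it has exactly `|w| + 1` distinct palindromic factors. -/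
def Rich (w : List A) : Prop :=
  ((factors w).filter (fun u => u.reverse = u)).card = w.length + 1

/-- `p` is a period of `w`. -/
def IsPeriod (w : List A) (p : ℕ) : Prop :=
  0 < p ∧ ∀ i : ℕ, i + p < w.length → w[i]? = w[i + p]?

/-- The minimal period of `w`. -/
noncomputable def minPeriod (w : List A) : ℕ := sInf {p : ℕ | IsPeriod w p}


def FL (v : List A) (n : ℕ) : Finset (List A) := (factors v).filter (fun u => u.length = n)

theorem mem_factors_iff (v u : List A) : u ∈ factors v ↔ u <:+: v := by
  unfold factors
  simp only [Finset.mem_image, Finset.mem_product, Finset.mem_range, Prod.exists]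
  constructor
  · rintro ⟨a, b, _, rfl⟩
    exact (List.take_prefix _ _).isInfix.trans (List.drop_suffix _ _).isInfix
  · rintro ⟨s, t, rfl⟩
    refine ⟨s.length, u.length, ⟨?_, ?_⟩, ?_⟩
    · simp
      try omega
    · simp
      try omega
    · simp

theorem mem_FL (v u : List A) (n : ℕ) : u ∈ FL v n ↔ u <:+: v ∧ u.length = n := by
  simp [FL, mem_factors_iff]

theorem C_eq (v : List A) (n : ℕ) : C v n = (FL v n).card := rfl

def RE (v u : List A) : Finset A := (Alph v).filter (fun x => u ++ [x] <:+: v)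

theorem mem_RE (v u : List A) (x : A) : x ∈ RE v u ↔ u ++ [x] <:+: v := by
  simp only [RE, Finset.mem_filter, Alph, List.mem_toFinset, and_iff_right_iff_imp]
  intro h
  exact h.subset (by simp)

theorem rv_eq (v u : List A) : rightValence v u = (RE v u).card := rfl

theorem RE_mono (v : List A) {s u : List A} (h : s <:+ u) : RE v u ⊆ RE v s := by
  intro x hx
  rw [mem_RE] at *
  obtain ⟨t, rfl⟩ := h
  refine List.IsInfix.trans ?_ hx
  exact ⟨t, [], by simp⟩

theorem rv_mono (v : List A) {s u : List A} (h : s <:+ u) :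
    rightValence v u ≤ rightValence v s := Finset.card_le_card (RE_mono v h)

theorem C_succ (v : List A) (n : ℕ) : C v (n+1) = ∑ u ∈ FL v n, rightValence v u := by
  rw [C_eq, Finset.card_eq_sum_card_fiberwise (f := List.dropLast) (t := FL v n)]
  · refine Finset.sum_congr rfl fun u hu => ?_
    rw [rv_eq, ← Finset.card_image_of_injective (RE v u) (f := fun x => u ++ [x])
      (fun x y hxy => by simpa using hxy)]
    congr 1
    ext z
    simp only [Finset.mem_filter, mem_FL, Finset.mem_image, mem_RE] at *
    constructor
    · rintro ⟨⟨h1, h2⟩, rfl⟩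
      have hz : z ≠ [] := by rintro rfl; simp at h2
      exact ⟨z.getLast hz, by rwa [List.dropLast_append_getLast], List.dropLast_append_getLast hz⟩
    · rintro ⟨x, h, rfl⟩
      exact ⟨⟨h, by simp [hu.2]⟩, by simp⟩
  · intro z hz
    simp only [Finset.mem_coe, mem_FL] at *
    exact ⟨(List.dropLast_prefix z).isInfix.trans hz.1, by simp [hz.2]⟩

theorem occ_iff (v u : List A) (h : u <:+ v) : occCount v u = 1 ↔ rightValence v u = 0 := by
  obtain ⟨t, rfl⟩ := h
  rw [rv_eq, Finset.card_eq_zero, Finset.eq_empty_iff_forall_notMem]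
  unfold occCount
  have hm : t.length ∈ ((Finset.range ((t++u).length + 1)).filter
    (fun i => i + u.length ≤ (t++u).length ∧ ((t++u).drop i).take u.length = u)) := by
    simp
  constructor
  · intro h x hx
    rw [mem_RE] at hx
    obtain ⟨a, b, hab⟩ := hx
    rw [Finset.card_eq_one] at h
    obtain ⟨c, hc⟩ := h
    have hl := congrArg List.length hab
    simp at hl
    have h2 : a.length ∈ ((Finset.range ((t++u).length + 1)).filter
      (fun i => i + u.length ≤ (t++u).length ∧ ((t++u).drop i).take u.length = u)) := by
      rw [Finset.mem_filter]
      refine ⟨by simp; omega, by simp; omega, ?_⟩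
      rw [← hab]; simp
    rw [hc, Finset.mem_singleton] at hm h2
    omega
  · intro h
    rw [Finset.card_eq_one]
    refine ⟨t.length, ?_⟩
    ext i
    rw [Finset.mem_singleton]
    constructor
    · intro hi
      rw [Finset.mem_filter] at hi
      obtain ⟨_, h1, h2⟩ := hi
      by_contra hne
      have h3 : i + u.length < (t++u).length := by simp at *; omega
      apply h ((t++u)[i+u.length])
      rw [mem_RE]
      have : u ++ [(t++u)[i+u.length]] = ((t++u).drop i).take (u.length+1) := by
        rw [List.take_add_one, h2]
        simp [List.getElem?_drop, h3]
        rw [List.getElem?_eq_getElem (by simpa using h3)]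
        simp
      rw [this]
      exact (List.take_prefix _ _).isInfix.trans (List.drop_suffix _ _).isInfix
    · rintro rfl; exact hm

theorem rv_self (v : List A) : rightValence v v = 0 := by
  rw [rv_eq, Finset.card_eq_zero, Finset.eq_empty_iff_forall_notMem]
  intro x hx
  rw [mem_RE] at hx
  have := hx.length_le
  simp at this

theorem K_le (v : List A) : K v ≤ v.length :=
  Nat.sInf_le ⟨v, List.suffix_refl v, rfl, (occ_iff v v (List.suffix_refl v)).2 (rv_self v)⟩

theorem K_spec (v : List A) : ∃ u, u <:+ v ∧ u.length = K v ∧ rightValence v u = 0 := by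
  have : K v ∈ {k : ℕ | ∃ u : List A, u <:+ v ∧ u.length = k ∧ occCount v u = 1} :=
    Nat.sInf_mem ⟨_, v, List.suffix_refl v, rfl, (occ_iff v v (List.suffix_refl v)).2 (rv_self v)⟩
  obtain ⟨u, h1, h2, h3⟩ := this
  exact ⟨u, h1, h2, (occ_iff v u h1).1 h3⟩

theorem rv_pos_of_not_suffix (v u : List A) (h : u <:+: v) (hs : ¬ u <:+ v) :
    1 ≤ rightValence v u := by
  obtain ⟨s, t, rfl⟩ := h
  rw [rv_eq, Nat.one_le_iff_ne_zero, ← Nat.pos_iff_ne_zero, Finset.card_pos]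
  cases t with
  | nil => exact absurd ⟨s, by simp⟩ hs
  | cons x t => exact ⟨x, (mem_RE _ _ _).2 ⟨s, t, by simp⟩⟩

theorem rv_pos_of_lt (v u : List A) (h : u <:+: v) (hk : u.length < K v) :
    1 ≤ rightValence v u := by
  by_cases hs : u <:+ v
  · by_contra hc
    have : K v ≤ u.length := Nat.sInf_le ⟨u, hs, rfl, (occ_iff v u hs).2 (by omega)⟩
    omega
  · exact rv_pos_of_not_suffix v u h hs

theorem suffix_exists (v : List A) (n : ℕ) (h1 : K v ≤ n) (h2 : n ≤ v.length) :
    ∃ p ∈ FL v n, rightValence v p = 0 ∧ ∀ u ∈ FL v n, u ≠ p → 1 ≤ rightValence v u := by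
  refine ⟨v.drop (v.length - n), ?_, ?_, ?_⟩
  · rw [mem_FL]; exact ⟨(List.drop_suffix _ _).isInfix, by simp; omega⟩
  · obtain ⟨u, hu, hl, h0⟩ := K_spec v
    have : u <:+ v.drop (v.length - n) := by
      apply List.suffix_of_suffix_length_le hu (List.drop_suffix _ _)
      simp; omega
    have := rv_mono v this
    omega
  · intro u hu hne
    rw [mem_FL] at hu
    apply rv_pos_of_not_suffix v u hu.1
    intro hs
    apply hne
    have := List.suffix_iff_eq_drop.1 hs
    rw [hu.2] at this
    exact this

theorem sum_aux {B : Type*} (s : Finset B) (f : B → ℕ) (h : ∀ b ∈ s, 1 ≤ f b) :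
    ∑ b ∈ s, f b = s.card + ∑ b ∈ s, (f b - 1) := by
  rw [Finset.card_eq_sum_ones, ← Finset.sum_add_distrib]
  exact Finset.sum_congr rfl fun b hb => by have := h b hb; omega

theorem C_succ_lt_K (v : List A) (n : ℕ) (hn : n < K v) :
    C v (n+1) = C v n + ∑ u ∈ FL v n, (rightValence v u - 1) := by
  rw [C_succ, sum_aux]; rfl
  intro b hb
  rw [mem_FL] at hb
  exact rv_pos_of_lt v b hb.1 (by omega)

theorem C_succ_ge_K (v : List A) (n : ℕ) (hn : K v ≤ n) (h2 : n ≤ v.length) :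
    C v (n+1) + 1 = C v n + ∑ u ∈ FL v n, (rightValence v u - 1) := by
  obtain ⟨p, hp, h0, h1⟩ := suffix_exists v n hn h2
  rw [C_succ, C_eq, ← Finset.add_sum_erase _ _ hp, ← Finset.add_sum_erase _ _ hp, h0,
    sum_aux, Finset.card_erase_of_mem hp]
  · have : 0 < (FL v n).card := Finset.card_pos.2 ⟨p, hp⟩
    omega
  · intro b hb
    rw [Finset.mem_erase] at hb
    exact h1 b hb.2 hb.1

theorem R_mem (v : List A) : 0 < R v ∧ ∀ u : List A, u.length = R v → ¬ RightSpecial v u := by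
  have : R v ∈ {r : ℕ | 0 < r ∧ ∀ u : List A, u.length = r → ¬ RightSpecial v u} := by
    apply Nat.sInf_mem
    refine ⟨v.length + 1, by omega, fun u hu h => ?_⟩
    have := h.1.length_le
    omega
  exact this

theorem R_le (v : List A) (hv : v ≠ []) : R v ≤ v.length := by
  apply Nat.sInf_le
  refine ⟨List.length_pos_of_ne_nil hv, fun u hu h => ?_⟩
  have : u = v := h.1.eq_of_length hu
  subst this
  have := h.2
  rw [rv_self] at this
  omega

theorem sum_ge_R (v : List A) (n : ℕ) (hn : R v ≤ n) :
    ∑ u ∈ FL v n, (rightValence v u - 1) = 0 := by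
  apply Finset.sum_eq_zero
  intro u hu
  rw [mem_FL] at hu
  by_contra hc
  apply (R_mem v).2 (u.drop (n - R v)) (by simp; omega)
  refine ⟨(List.drop_suffix _ _).isInfix.trans hu.1, ?_⟩
  have := rv_mono v (List.drop_suffix (n - R v) u)
  omega

theorem sum_lt_R (v : List A) (n : ℕ) (hn : n < R v) (h0 : 1 ≤ n) :
    1 ≤ ∑ u ∈ FL v n, (rightValence v u - 1) := by
  have : n ∉ {r : ℕ | 0 < r ∧ ∀ u : List A, u.length = r → ¬ RightSpecial v u} :=
    Nat.notMem_of_lt_sInf hn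
  simp only [Set.mem_ofPred_eq, not_and, not_forall, not_not] at this
  obtain ⟨u, hu, h1, h2⟩ := this h0
  have := Finset.single_le_sum (f := fun u => rightValence v u - 1) (fun _ _ => Nat.zero_le _)
    ((mem_FL v u n).2 ⟨h1, hu⟩)
  omega

theorem C_top (v : List A) : C v v.length = 1 := by
  rw [C_eq, Finset.card_eq_one]
  refine ⟨v, ?_⟩
  ext u
  rw [mem_FL, Finset.mem_singleton]
  exact ⟨fun h => h.1.eq_of_length h.2, by rintro rfl; simp⟩

theorem C_one (v : List A) : C v 1 = (Alph v).card := by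
  rw [C_eq, ← Finset.card_image_of_injective (Alph v) (f := fun x => [x])
      (fun x y hxy => by simpa using hxy)]
  congr 1
  ext u
  simp only [mem_FL, Finset.mem_image, Alph, List.mem_toFinset]
  constructor
  · rintro ⟨h1, h2⟩
    obtain ⟨x, rfl⟩ := List.length_eq_one_iff.1 h2
    exact ⟨x, h1.subset (by simp), rfl⟩
  · rintro ⟨x, hx, rfl⟩
    obtain ⟨s, t, rfl⟩ := List.append_of_mem hx
    exact ⟨⟨s, t, by simp⟩, rfl⟩

/-! Abstract profile facts -/

structure Prof (f : ℕ → ℕ) (a N r k : ℕ) : Prop where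
  one : f 1 = a
  top : f N = 1
  r1 : 1 ≤ r
  rN : r ≤ N
  kN : k ≤ N
  inc : ∀ n, 1 ≤ n → n < r → n < k → f n + 1 ≤ f (n+1)
  mid : ∀ n, r ≤ n → n < k → f (n+1) = f n
  mid2 : ∀ n, 1 ≤ n → k ≤ n → n < r → f n ≤ f (n+1)
  dec : ∀ n, r ≤ n → k ≤ n → n ≤ N → f (n+1) + 1 = f n

theorem prof (v : List A) (hv : v ≠ []) : Prof (C v) (Alph v).card v.length (R v) (K v) where
  one := C_one v
  top := C_top v
  r1 := (R_mem v).1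
  rN := R_le v hv
  kN := K_le v
  inc n h0 h1 h2 := by
    have := C_succ_lt_K v n h2
    have := sum_lt_R v n h1 h0
    omega
  mid n h1 h2 := by
    have := C_succ_lt_K v n h2
    have := sum_ge_R v n h1
    omega
  mid2 n h0 h1 h2 := by
    have := C_succ_ge_K v n h1 (by have := R_le v hv; omega)
    have := sum_lt_R v n h2 h0
    omega
  dec n h1 h2 h3 := by
    have := C_succ_ge_K v n h2 h3
    have := sum_ge_R v n h1
    omega

theorem Prof.mono {f : ℕ → ℕ} {a N r k : ℕ} (P : Prof f a N r k) (n : ℕ) (h : 1 ≤ n)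
    (h2 : n < max r k) : f n ≤ f (n+1) := by
  rcases lt_or_ge n r with h3 | h3
  · rcases lt_or_ge n k with h4 | h4
    · have := P.inc n h h3 h4; omega
    · exact P.mid2 n h h4 h3
  · rcases lt_or_ge n k with h4 | h4
    · exact (P.mid n h3 h4).ge
    · omega

theorem Prof.monoLe {f : ℕ → ℕ} {a N r k : ℕ} (P : Prof f a N r k) (i j : ℕ) (h : 1 ≤ i)
    (hij : i ≤ j) (h2 : j ≤ max r k) : f i ≤ f j := by
  induction j, hij using Nat.le_induction with
  | base => exact le_rfl
  | succ j hj ih => exact (ih (by omega)).trans (P.mono j (by omega) (by omega))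

theorem Prof.incLe {f : ℕ → ℕ} {a N r k : ℕ} (P : Prof f a N r k) (i j : ℕ) (h : 1 ≤ i)
    (hij : i ≤ j) (h2 : j ≤ min r k) : f i + (j - i) ≤ f j := by
  induction j, hij using Nat.le_induction with
  | base => simp
  | succ j hj ih =>
    have := ih (by omega)
    have := P.inc j (by omega) (by omega) (by omega)
    omega

theorem Prof.decEq {f : ℕ → ℕ} {a N r k : ℕ} (P : Prof f a N r k) (j : ℕ)
    (h : j ≤ N) (h2 : max r k ≤ j) : f j + (j - max r k) = f (max r k) := by
  induction j, h2 using Nat.le_induction with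
  | base => simp
  | succ j hj ih =>
    have := ih (by omega)
    have := P.dec j (by omega) (by omega) (by omega)
    omega

theorem Prof.fM {f : ℕ → ℕ} {a N r k : ℕ} (P : Prof f a N r k) :
    f (max r k) + max r k = N + 1 := by
  have := P.decEq N le_rfl (by have := P.rN; have := P.kN; omega)
  have := P.rN
  have := P.kN
  have := P.top
  omega

theorem Prof.le {f : ℕ → ℕ} {a N r k : ℕ} (P : Prof f a N r k) (hk : 1 ≤ k) :
    r + k + a ≤ N + 2 := by
  have h1 := P.incLe 1 (min r k) le_rfl (by have := P.r1; omega) le_rfl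
  have h2 := P.monoLe (min r k) (max r k) (by have := P.r1; omega) (by omega) le_rfl
  have := P.fM
  have := P.one
  have := P.r1
  omega

theorem Prof.eq_inc {f : ℕ → ℕ} {a N r k : ℕ} (P : Prof f a N r k) (hk : 1 ≤ k)
    (he : N + 2 = r + k + a) (n : ℕ) (h1 : 1 ≤ n) (h2 : n < min r k) : f (n+1) = f n + 1 := by
  have h3 := P.incLe 1 n le_rfl h1 (by omega)
  have h4 := P.incLe (n+1) (min r k) (by omega) (by omega) le_rfl
  have h5 := P.monoLe (min r k) (max r k) (by omega) (by omega) le_rfl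
  have := P.fM
  have := P.one
  have := P.inc n h1 (by omega) (by omega)
  omega

theorem Prof.max_le {f : ℕ → ℕ} {a N r k l h : ℕ} (P : Prof f a N r k) (Q : Prof f a N l h) :
    max l h ≤ max r k := by
  by_contra hc
  have h1 := P.r1
  have h2 := Q.mono (max r k) (by omega) (by omega)
  have h3 := P.dec (max r k) (by omega) (by omega) (by have := P.rN; have := P.kN; omega)
  omega

theorem Prof.main {f : ℕ → ℕ} {a N r k l h : ℕ} (P : Prof f a N r k) (Q : Prof f a N l h)
    (hk : 1 ≤ k) (hh : 2 ≤ h) (he : N + 2 = r + k + a)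
    (key : h < r → h < k → f h = f (h-1) + 1 → f (h+1) = f h + 1 → False) :
    N + 2 = l + h + a := by
  have h1 := P.max_le Q
  have h2 := Q.max_le P
  have h3 := Q.le (by omega)
  have h4 := Q.r1
  suffices min r k ≤ min l h by omega
  by_contra hc
  rcases lt_or_ge l h with h5 | h5
  · have := Q.mid l le_rfl h5
    have := P.eq_inc hk he l (by omega) (by omega)
    omega
  · apply key (by omega) (by omega)
    · have := P.eq_inc hk he (h-1) (by omega) (by omega)
      rwa [show h - 1 + 1 = h by omega] at this
    · exact P.eq_inc hk he h (by omega) (by omega)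

theorem key1 (v : List A) (hh : 1 ≤ K v)
    (h1 : C v (K v) = C v (K v - 1) + 1) (h2 : C v (K v + 1) = C v (K v) + 1) :
    ∃ (u : List A) (x y a b : A), u.length + 1 = K v ∧ x ≠ y ∧ a ≠ b ∧
      x :: u ++ [a] <:+: v ∧ x :: u ++ [b] <:+: v ∧ y :: u ++ [a] <:+: v ∧
      y :: u ++ [b] <:+: v := by
  obtain ⟨k, hk⟩ : ∃ k, K v = k + 1 := ⟨K v - 1, by omega⟩
  have e1 := C_succ_lt_K v k (by omega)
  have e2 := C_succ_ge_K v (K v) le_rfl (K_le v)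
  rw [hk] at h1 h2 e2
  simp only [Nat.add_sub_cancel] at h1
  have s1 : ∑ u ∈ FL v k, (rightValence v u - 1) = 1 := by omega
  have s2 : ∑ u ∈ FL v (k+1), (rightValence v u - 1) = 2 := by omega
  clear e1 e2 h1 h2
  have rv2 : ∀ u ∈ FL v k, rightValence v u ≤ 2 := by
    intro u hu
    have := Finset.single_le_sum (f := fun u => rightValence v u - 1) (fun _ _ => Nat.zero_le _) hu
    omega
  have huniq : ∀ u ∈ FL v k, ∀ u' ∈ FL v k, 2 ≤ rightValence v u → 2 ≤ rightValence v u' →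
      u = u' := by
    intro u hu u' hu' g g'
    by_contra hne
    have := Finset.sum_le_sum_of_subset (f := fun u => rightValence v u - 1)
      (show ({u, u'} : Finset (List A)) ⊆ FL v k by
        intro z hz; simp at hz; rcases hz with rfl | rfl <;> assumption)
    rw [Finset.sum_pair hne] at this
    omega
  have tl : ∀ s ∈ FL v (k+1), 2 ≤ rightValence v s → ∃ x u, s = x :: u ∧ u ∈ FL v k ∧
      2 ≤ rightValence v u ∧ RE v s = RE v u ∧ rightValence v s = 2 := by
    intro s hs h
    rw [mem_FL] at hs
    cases s with
    | nil => simp at hs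
    | cons x u =>
      have hsuf : u <:+ x :: u := List.suffix_cons x u
      have hu : u ∈ FL v k := by
        rw [mem_FL]; exact ⟨hsuf.isInfix.trans hs.1, by simpa using hs.2⟩
      have g1 := rv_mono v hsuf
      have g2 := rv2 u hu
      refine ⟨x, u, rfl, hu, by omega, ?_, by omega⟩
      apply Finset.eq_of_subset_of_card_le (RE_mono v hsuf)
      rw [← rv_eq, ← rv_eq]; omega
  have hc : 1 < ((FL v (k+1)).filter (fun s => 2 ≤ rightValence v s)).card := by
    rw [Finset.card_filter]
    refine lt_of_lt_of_le (show 1 < 2 by omega) ?_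
    refine s2.ge.trans ?_
    apply Finset.sum_le_sum
    intro s hs
    split_ifs with h
    · obtain ⟨x, u, _, _, _, _, h⟩ := tl s hs h
      omega
    · omega
  obtain ⟨s, hs, s', hs', hne⟩ := Finset.one_lt_card.1 hc
  rw [Finset.mem_filter] at hs hs'
  obtain ⟨x, u, rfl, hu, hu2, hRE, hrv⟩ := tl s hs.1 hs.2
  obtain ⟨y, u', rfl, hu', hu2', hRE', _⟩ := tl s' hs'.1 hs'.2
  obtain rfl := huniq u hu u' hu' hu2 hu2'
  obtain ⟨a, ha, b, hb, hab⟩ := Finset.one_lt_card.1 (show 1 < (RE v u).card from hu2)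
  refine ⟨u, x, y, a, b, ?_, ?_, hab, ?_, ?_, ?_, ?_⟩
  · rw [mem_FL] at hu; omega
  · rintro rfl; exact hne rfl
  · rw [← hRE, mem_RE] at ha; exact ha
  · rw [← hRE, mem_RE] at hb; exact hb
  · rw [← hRE', mem_RE] at ha; exact ha
  · rw [← hRE', mem_RE] at hb; exact hb

/-! Reversal -/

theorem C_rev (v : List A) (n : ℕ) : C v.reverse n = C v n := by
  rw [C_eq, C_eq, ← Finset.card_image_of_injective (FL v n) List.reverse_injective]
  congr 1
  ext u
  simp only [mem_FL, Finset.mem_image]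
  constructor
  · rintro ⟨h1, h2⟩
    exact ⟨u.reverse, ⟨by rw [← List.reverse_infix]; simpa using h1, by simpa using h2⟩, by simp⟩
  · rintro ⟨z, ⟨h1, h2⟩, rfl⟩
    exact ⟨List.reverse_infix.2 h1, by simpa using h2⟩

theorem Alph_rev (v : List A) : Alph v.reverse = Alph v := by
  ext x; simp [Alph]

theorem lv_eq (v u : List A) : leftValence v u = rightValence v.reverse u.reverse := by
  unfold leftValence rightValence
  rw [Alph_rev]
  congr 1
  apply Finset.filter_congr
  intro x _
  rw [← List.reverse_infix (l₁ := x :: u)]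
  simp

theorem L_eq (v : List A) : L v = R v.reverse := by
  unfold L R
  congr 1
  ext r
  simp only [Set.mem_ofPred_eq, and_congr_right_iff]
  intro _
  constructor
  · intro h u hu hs
    apply h u.reverse (by simpa using hu)
    refine ⟨by rw [← List.reverse_infix]; simpa using hs.1, ?_⟩
    rw [lv_eq]; simpa using hs.2
  · intro h u hu hs
    apply h u.reverse (by simpa using hu)
    refine ⟨List.reverse_infix.2 hs.1, ?_⟩
    rw [← lv_eq]; exact hs.2

theorem occ_rev (v u : List A) : occCount v.reverse u.reverse = occCount v u := by
  unfold occCount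
  refine Finset.card_bij' (fun i _ => v.length - u.length - i) (fun i _ => v.length - u.length - i)
    ?_ ?_ ?_ ?_
  · intro i hi
    simp only [Finset.mem_filter, Finset.mem_range, List.length_reverse] at *
    obtain ⟨_, h1, h2⟩ := hi
    refine ⟨by omega, by omega, ?_⟩
    rw [← List.reverse_inj, ← h2]
    rw [List.reverse_take, List.reverse_drop, List.length_drop, List.drop_take,
      List.take_eq_take_iff.2]
    · congr 2; omega
    · simp; omega
  · intro i hi
    simp only [Finset.mem_filter, Finset.mem_range, List.length_reverse] at *
    obtain ⟨_, h1, h2⟩ := hi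
    refine ⟨by omega, by omega, ?_⟩
    conv_rhs => rw [← h2]
    rw [List.reverse_take, List.reverse_drop, List.length_drop, List.drop_take]
    congr 1
    · omega
    · congr 1; omega
  · intro i hi
    simp only [Finset.mem_filter, Finset.mem_range, List.length_reverse] at *
    omega
  · intro i hi
    simp only [Finset.mem_filter, Finset.mem_range, List.length_reverse] at *
    omega

theorem H_eq (v : List A) : H v = K v.reverse := by
  unfold H K
  congr 1
  ext k
  simp only [Set.mem_ofPred_eq]
  constructor
  · rintro ⟨u, h1, h2, h3⟩
    exact ⟨u.reverse, List.reverse_suffix.2 h1, by simpa using h2, by rwa [occ_rev]⟩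
  · rintro ⟨u, h1, h2, h3⟩
    refine ⟨u.reverse, ?_, by simpa using h2, ?_⟩
    · rw [← List.reverse_suffix]; simpa using h1
    · rw [← occ_rev]; simpa using h3

theorem half (v : List A) (hv : v ≠ []) (hk : 1 ≤ K v) (hh : 2 ≤ K v.reverse)
    (he : v.length + 2 = R v + K v + (Alph v).card) :
    v.length + 2 = R v.reverse + K v.reverse + (Alph v).card := by
  have Q := prof v.reverse (by simpa using hv)
  rw [Alph_rev, List.length_reverse, show C v.reverse = C v from funext (C_rev v)] at Q
  refine (prof v hv).main Q hk hh he ?_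
  intro _ g2 g3 g4
  have : ∃ (u : List A) (x y a b : A), u.length + 1 = K v.reverse ∧ x ≠ y ∧ a ≠ b ∧
      x :: u ++ [a] <:+: v.reverse ∧ x :: u ++ [b] <:+: v.reverse ∧
      y :: u ++ [a] <:+: v.reverse ∧ y :: u ++ [b] <:+: v.reverse := by
    apply key1 v.reverse (by omega) <;> simpa only [C_rev]
  obtain ⟨u, x, y, a, b, hl, hxy, hab, i1, i2, i3, i4⟩ := this
  have tr : ∀ (x a : A), x :: u ++ [a] <:+: v.reverse → x ∈ RE v (a :: u.reverse) := by
    intro x a h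
    rw [mem_RE, ← List.reverse_infix]
    simpa using h
  have rs : ∀ a : A, x ∈ RE v (a :: u.reverse) → y ∈ RE v (a :: u.reverse) →
      2 ≤ rightValence v (a :: u.reverse) := fun a h1 h2 =>
    Finset.one_lt_card.2 ⟨x, h1, y, h2, hxy⟩
  have mm : ∀ a : A, x ∈ RE v (a :: u.reverse) → a :: u.reverse ∈ FL v (K v.reverse) := by
    intro a h
    rw [mem_RE] at h
    rw [mem_FL]
    exact ⟨(List.prefix_append _ _).isInfix.trans h, by simpa using hl⟩
  have ra := rs a (tr _ _ i1) (tr _ _ i3)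
  have rb := rs b (tr _ _ i2) (tr _ _ i4)
  have ma := mm a (tr _ _ i1)
  have mb := mm b (tr _ _ i2)
  have hne : a :: u.reverse ≠ b :: u.reverse := by simpa using hab
  have := Finset.sum_le_sum_of_subset (f := fun u => rightValence v u - 1)
      (show ({a :: u.reverse, b :: u.reverse} : Finset (List A)) ⊆ FL v (K v.reverse) by
        intro z hz; simp only [Finset.mem_insert, Finset.mem_singleton] at hz
        rcases hz with rfl | rfl <;> assumption)
  rw [Finset.sum_pair hne] at this
  have := C_succ_lt_K v _ g2
  omega

/-! Heart -/

theorem strip (r v : List A) (h : ∀ x ∈ r, (r ++ v).count x = 1) :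
    (r ++ v).length + (Alph v).card = v.length + (Alph (r ++ v)).card ∧
    ∀ x ∈ v, v.count x = (r ++ v).count x := by
  induction r with
  | nil => simp
  | cons y r ih =>
    have hy : y ∉ r ++ v := by
      have := h y (by simp)
      rw [List.cons_append, List.count_cons_self] at this
      rw [← List.count_eq_zero]; omega
    have := ih (fun x hx => by
      have h1 := h x (by simp [hx])
      rwa [List.cons_append, List.count_cons_of_ne (by rintro rfl; apply hy; simp [hx])] at h1)
    constructor
    · have e : (Alph (y :: r ++ v)).card = (Alph (r ++ v)).card + 1 := by
        unfold Alph
        rw [List.cons_append, List.toFinset_cons, Finset.card_insert_of_notMem (by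
          rwa [List.mem_toFinset])]
      rw [e, List.cons_append, List.length_cons]; omega
    · intro x hx
      rw [this.2 x hx, List.cons_append,
        List.count_cons_of_ne (by rintro rfl; apply hy; simp [hx])]

theorem dw (w : List A) (p : A → Bool) (hp : ∀ x ∈ w, p x → w.count x = 1) :
    w.length + (Alph (w.dropWhile p)).card = (w.dropWhile p).length + (Alph w).card ∧
    ∀ x ∈ w.dropWhile p, (w.dropWhile p).count x = w.count x := by
  have := strip (w.takeWhile p) (w.dropWhile p) (by
    intro x hx
    rw [List.takeWhile_append_dropWhile]
    exact hp x ((List.takeWhile_prefix p).subset hx) (List.mem_takeWhile_imp hx))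
  rwa [List.takeWhile_append_dropWhile] at this

theorem K_two (t : List A) (x : A) (hx : x ∈ t) : 2 ≤ K (t ++ [x]) := by
  obtain ⟨u, h1, h2, h3⟩ := K_spec (t ++ [x])
  by_contra hk
  have hu : u <:+ [x] := by
    apply List.suffix_of_suffix_length_le h1 (List.suffix_append _ _)
    simp; omega
  have h0 : rightValence (t ++ [x]) [x] = 0 := by
    have := rv_mono (t ++ [x]) hu; omega
  rw [rv_eq, Finset.card_eq_zero, Finset.eq_empty_iff_forall_notMem] at h0
  obtain ⟨a, b, rfl⟩ := List.append_of_mem hx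
  cases b with
  | nil => exact h0 x ((mem_RE _ _ _).2 ⟨a, [], by simp⟩)
  | cons y b => exact h0 y ((mem_RE _ _ _).2 ⟨a, b ++ [x], by simp⟩)

theorem K_pos (v : List A) (hv : v ≠ []) : 1 ≤ K v := by
  obtain ⟨u, h1, h2, h3⟩ := K_spec v
  by_contra hk
  have : u = [] := List.length_eq_zero_iff.1 (by omega)
  subst this
  have := rv_pos_of_not_suffix v [v.head hv]
  rw [rv_eq, Finset.card_eq_zero, Finset.eq_empty_iff_forall_notMem] at h3
  cases v with
  | nil => exact hv rfl
  | cons x v => exact h3 x ((mem_RE _ _ _).2 ⟨[], v, by simp⟩)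

theorem K_two' (u : List A) (x : A) (hx : (x :: u).count x ≠ 1) : 2 ≤ K (x :: u).reverse := by
  rw [List.reverse_cons]
  apply K_two
  rw [List.count_cons_self] at hx
  rw [List.mem_reverse, ← List.count_pos_iff]
  omega

theorem heart_case (v : List A) (h1 : 2 ≤ K v) (h2 : 2 ≤ K v.reverse) (hv : v ≠ []) :
    v.length + 2 = R v + K v + (Alph v).card ↔
    v.length + 2 = R v.reverse + K v.reverse + (Alph v).card := by
  constructor
  · exact half v hv (by omega) h2
  · intro h
    have := half v.reverse (by simpa using hv) (by omega) (by simpa using h1)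
    simp only [List.reverse_reverse, Alph_rev, List.length_reverse] at this
    exact this h

theorem dw_head (l : List A) (p : A → Bool) (x : A) (u : List A)
    (h : l.dropWhile p = x :: u) : p x = false := by
  have := List.head?_dropWhile_not p l
  rw [h] at this
  simpa using this

theorem stmt6 (w : List A) (hw : w ≠ []) (v : List A) (hv : v = heart w) :
    w.length + 2 = R v + K v + (Alph w).card ↔
    w.length + 2 = L v + H v + (Alph w).card := by
  rw [L_eq, H_eq]
  unfold heart at hv
  split_ifs at hv with hc
  · subst hv
    have hN : (Alph v).card = v.length := by
      apply List.toFinset_card_of_nodup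
      rw [List.nodup_iff_count_le_one]
      intro x
      by_cases hx : x ∈ v
      · exact (hc x hx).le
      · rw [List.count_eq_zero_of_not_mem hx]; omega
    have hw' : v.reverse ≠ [] := by simpa using hw
    have P := (prof v hw).le (K_pos v hw)
    have Q := (prof v.reverse hw').le (K_pos _ hw')
    rw [Alph_rev, List.length_reverse] at Q
    have := (R_mem v).1
    have := (R_mem v.reverse).1
    have := K_pos v hw
    have := K_pos _ hw'
    omega
  · by_cases hne : v = []
    · subst hne; rfl
    have d1 := dw w (fun x => w.count x == 1) (by intro x _ h; simpa using h)
    have hh1 := dw_head w (fun x => w.count x == 1)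
    generalize w.dropWhile (fun x => w.count x == 1) = w1 at *
    have d2 := dw w1.reverse (fun x => w.count x == 1) (by
      intro x hx h
      rw [List.count_reverse, d1.2 x (by simpa using hx)]; simpa using h)
    have hh2 := dw_head w1.reverse (fun x => w.count x == 1)
    have hsuf := List.dropWhile_suffix (l := w1.reverse) (fun x => w.count x == 1)
    generalize w1.reverse.dropWhile (fun x => w.count x == 1) = w2 at *
    subst hv
    have hcount : ∀ x ∈ w2, w2.count x = w.count x := by
      intro x hx
      rw [d2.2 x hx, List.count_reverse, d1.2 x (by simpa using hsuf.subset hx)]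
    have hne2 : w2 ≠ [] := by simpa using hne
    have hK : 2 ≤ K w2.reverse := by
      cases w2 with
      | nil => exact absurd rfl hne2
      | cons x u =>
        apply K_two'
        rw [hcount x (by simp)]
        simpa using hh2 x u rfl
    have hH : 2 ≤ K w2 := by
      have hpre : w2.reverse <+: w1 := by
        rw [← List.reverse_suffix]; simpa using hsuf
      rw [← List.reverse_reverse w2]
      have hcount' : ∀ x ∈ w2.reverse, w2.reverse.count x = w.count x := by
        intro x hx
        rw [List.count_reverse]; exact hcount x (by simpa using hx)
      generalize w2.reverse = z at *
      cases z with
      | nil => exact absurd rfl hne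
      | cons x u =>
        apply K_two'
        rw [hcount' x (by simp)]
        obtain ⟨t, rfl⟩ := hpre
        simpa using hh1 x (u ++ t) rfl
    have := heart_case w2.reverse hK (by simpa using hH) hne
    rw [Alph_rev] at this
    simp only [List.reverse_reverse, List.length_reverse] at *
    have e1 := d1.1
    have e2 := d2.1
    rw [Alph_rev] at e2
    omega
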